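/- Let o₁,…,o_{m₂} be independent random vectors in ℝⁿ, each with independent Gaussian coordinates of mean 0 and variance 1/n (i.e., each oᵢ ~ N(0, (1/n)Iₙ)), and let o denote a further vector with the same distribution. Then E[ sup{ ∑_{i=1}^{m₂} ( ‖Bᵀoᵢ‖₂ − E[‖Bᵀo‖₂] ) : B ∈ ℝ^{n×r}, ‖B‖_F = 1 } ] ≤ 2√(2 m₂ r), where the inner expectation E[‖Bᵀo‖₂] is taken with respect to a single copy o and the outer expectation with respect to (o₁,…,o_{m₂}). -/

import Mathlib

open Matrix MeasureTheory ProbabilityTheory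

noncomputable section

/-- Frobenius norm of a real matrix. -/
def fnorm {n r : ℕ} (A : Matrix (Fin n) (Fin r) ℝ) : ℝ :=
  Real.sqrt ((Aᵀ * A).trace)

/-- Euclidean norm of a vector. -/
def vnorm {k : ℕ} (v : Fin k → ℝ) : ℝ := Real.sqrt (∑ i, v i ^ 2)

/-- Law of a random vector in ℝᵏ with independent N(0, σ²) coordinates. -/
def gaussianVec (k : ℕ) (σ2 : NNReal) : Measure (Fin k → ℝ) :=
  Measure.pi fun _ : Fin k => gaussianReal 0 σ2

lemma integral_abs_gaussianReal_zero_one :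
    ∫ x, |x| ∂(gaussianReal 0 1) = 2 / Real.sqrt (2 * Real.pi) := by
  rw [integral_gaussianReal_eq_integral_smul one_ne_zero]
  have h : ∀ x : ℝ, gaussianPDFReal 0 1 x • |x| =
      (fun y : ℝ ↦ (Real.sqrt (2 * Real.pi))⁻¹ * (y ^ (1 : ℝ) * Real.exp (-(1 / 2) * y ^ (2 : ℝ))))
        |x| := by
    intro x
    simp only [gaussianPDFReal, smul_eq_mul, NNReal.coe_one, mul_one, sub_zero, Real.rpow_one,
      Real.rpow_two, sq_abs]
    rw [show -x ^ 2 / 2 = -(1 / 2) * x ^ 2 by ring]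
    ring
  simp_rw [h]
  rw [integral_comp_abs (f := fun y : ℝ ↦
    (Real.sqrt (2 * Real.pi))⁻¹ * (y ^ (1 : ℝ) * Real.exp (-(1 / 2) * y ^ (2 : ℝ)))), integral_const_mul,
    integral_rpow_mul_exp_neg_mul_rpow (by norm_num) (by norm_num) (by norm_num)]
  norm_num
  field_simp

lemma one_le_sqrt_two_mul_integral_abs_gaussianReal :
    1 ≤ Real.sqrt 2 * ∫ x, |x| ∂(gaussianReal 0 1) := by
  have hpi : 0 < Real.sqrt Real.pi := Real.sqrt_pos.2 Real.pi_pos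
  have h2 : Real.sqrt Real.pi ≤ 2 := by
    rw [Real.sqrt_le_left (by norm_num)]
    linarith [Real.pi_le_four]
  rw [integral_abs_gaussianReal_zero_one, Real.sqrt_mul (by norm_num)]
  have : Real.sqrt 2 * (2 / (Real.sqrt 2 * Real.sqrt Real.pi)) = 2 / Real.sqrt Real.pi := by
    field_simp
  rw [this, one_le_div hpi]
  exact h2

lemma vnorm_eq_norm {k : ℕ} (v : Fin k → ℝ) : vnorm v = ‖WithLp.toLp 2 v‖ := by
  simp [vnorm, EuclideanSpace.norm_eq]

lemma map_dotProduct_gaussianVec {k : ℕ} (v : Fin k → ℝ) :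
    (gaussianVec k 1).map (fun g ↦ g ⬝ᵥ v) =
      (gaussianReal 0 1).map (fun x ↦ vnorm v * x) := by
  let L : StrongDual ℝ (EuclideanSpace ℝ (Fin k)) := innerSL ℝ (WithLp.toLp 2 v)
  have hL : (fun g : Fin k → ℝ ↦ g ⬝ᵥ v) = L ∘ WithLp.toLp 2 := by
    ext g
    simp [L, PiLp.inner_apply, dotProduct]
  rw [hL, ← Measure.map_map (by fun_prop) (by fun_prop), gaussianVec, map_pi_eq_stdGaussian,
    IsGaussian.map_eq_gaussianReal, integral_strongDual_stdGaussian, variance_dual_stdGaussian,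
    gaussianReal_map_const_mul]
  congr 1
  · simp
  · ext
    simp [L, vnorm_eq_norm]

lemma vnorm_le_integral_abs_dotProduct {k : ℕ} (v : Fin k → ℝ) :
    vnorm v ≤ ∫ g, |Real.sqrt 2 * (g ⬝ᵥ v)| ∂(gaussianVec k 1) := by
  have hv : 0 ≤ vnorm v := Real.sqrt_nonneg _
  have h : ∫ g, |Real.sqrt 2 * (g ⬝ᵥ v)| ∂(gaussianVec k 1) =
      ∫ x, |Real.sqrt 2 * (vnorm v * x)| ∂(gaussianReal 0 1) := by
    rw [← integral_map (φ := fun g ↦ g ⬝ᵥ v) (f := fun x ↦ |Real.sqrt 2 * x|) (by fun_prop)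
      (by fun_prop), map_dotProduct_gaussianVec, integral_map (by fun_prop) (by fun_prop)]
  rw [h]
  simp_rw [abs_mul, abs_of_nonneg hv, abs_of_nonneg (Real.sqrt_nonneg 2)]
  rw [integral_const_mul, integral_const_mul]
  nlinarith [one_le_sqrt_two_mul_integral_abs_gaussianReal]

instance {k : ℕ} {σ2 : NNReal} : IsProbabilityMeasure (gaussianVec k σ2) := by
  unfold gaussianVec; infer_instance

lemma integrable_eval_gaussianVec {k : ℕ} {σ2 : NNReal} (i : Fin k) :
    Integrable (fun v ↦ v i) (gaussianVec k σ2) :=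
  integrable_eval IsGaussian.integrable_id

lemma integral_eval_gaussianVec {k : ℕ} {σ2 : NNReal} (i : Fin k) :
    ∫ v, v i ∂(gaussianVec k σ2) = 0 := by
  rw [gaussianVec, integral_eval, integral_id_gaussianReal]

lemma integrable_sq_eval_gaussianVec {k : ℕ} {σ2 : NNReal} (i : Fin k) :
    Integrable (fun v ↦ v i ^ 2) (gaussianVec k σ2) := by
  have h : Integrable (fun x : ℝ ↦ x ^ 2) (gaussianReal 0 σ2) :=
    (memLp_id_gaussianReal 2).integrable_sq
  exact integrable_comp_eval (μ := fun _ : Fin k ↦ gaussianReal 0 σ2) h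

lemma integrable_sum_sq_gaussianVec {k : ℕ} {σ2 : NNReal} :
    Integrable (fun v ↦ ∑ i, v i ^ 2) (gaussianVec k σ2) :=
  integrable_finsetSum _ fun i _ ↦ integrable_sq_eval_gaussianVec i

lemma integral_sum_sq_gaussianVec {k : ℕ} {σ2 : NNReal} :
    ∫ v, ∑ i, v i ^ 2 ∂(gaussianVec k σ2) = k * σ2 := by
  have h1 : ∫ x, x ^ 2 ∂(gaussianReal 0 σ2) = σ2 := by
    rw [← variance_id_gaussianReal (μ := 0) (v := σ2),
      variance_of_integral_eq_zero aemeasurable_id (by simp [integral_id_gaussianReal])]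
    rfl
  rw [integral_finsetSum]
  · simp only [gaussianVec]
    have : ∀ i : Fin k, ∫ v : Fin k → ℝ, v i ^ 2 ∂(Measure.pi fun _ ↦ gaussianReal 0 σ2) = σ2 := by
      intro i
      rw [integral_comp_eval (μ := fun _ : Fin k ↦ gaussianReal 0 σ2) (i := i)
        (f := fun x : ℝ ↦ x ^ 2) (by fun_prop), h1]
    simp [this]
  · exact fun i _ ↦ integrable_sq_eval_gaussianVec i

lemma vnorm_sub_le {k : ℕ} (x y : Fin k → ℝ) : vnorm x - vnorm y ≤ vnorm (x - y) := by
  simp only [vnorm_eq_norm, WithLp.toLp_sub]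
  exact norm_sub_norm_le _ _

lemma continuous_vnorm {k : ℕ} : Continuous (vnorm (k := k)) := by
  unfold vnorm; fun_prop

lemma integrable_vnorm_gaussianVec {k : ℕ} {σ2 : NNReal} :
    Integrable vnorm (gaussianVec k σ2) := by
  refine ((integrable_const 1).add integrable_sum_sq_gaussianVec).mono'
    continuous_vnorm.aestronglyMeasurable (.of_forall fun v ↦ ?_)
  have h0 : 0 ≤ ∑ i, v i ^ 2 := Finset.sum_nonneg fun i _ ↦ sq_nonneg _
  rw [vnorm, Real.norm_of_nonneg (Real.sqrt_nonneg _), Pi.add_apply]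
  nlinarith [Real.sq_sqrt h0, sq_nonneg (Real.sqrt (∑ i, v i ^ 2) - 1)]

lemma measurePreserving_neg_gaussianVec {k : ℕ} {σ2 : NNReal} :
    MeasurePreserving (MeasurableEquiv.neg (Fin k → ℝ)) (gaussianVec k σ2) (gaussianVec k σ2) :=
  measurePreserving_pi _ _ fun _ ↦ ⟨measurable_neg,
    gaussianReal_map_neg.trans (by rw [neg_zero])⟩

lemma integral_comp_neg_gaussianVec {k : ℕ} {σ2 : NNReal} (f : (Fin k → ℝ) → ℝ) :
    ∫ g, f (-g) ∂(gaussianVec k σ2) = ∫ g, f g ∂(gaussianVec k σ2) :=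
  measurePreserving_neg_gaussianVec.integral_comp' f

lemma integrable_comp_neg_gaussianVec {k : ℕ} {σ2 : NNReal} {f : (Fin k → ℝ) → ℝ}
    (hf : Integrable f (gaussianVec k σ2)) :
    Integrable (fun g ↦ f (-g)) (gaussianVec k σ2) :=
  (measurePreserving_neg_gaussianVec.integrable_comp_emb
    (MeasurableEquiv.neg (Fin k → ℝ)).measurableEmbedding).2 hf

lemma abs_iSup_le_of_forall_abs_le {T : Type*} [Nonempty T] {f : T → ℝ} {b : ℝ} (hb : ∀ t, |f t| ≤ b) :
    |⨆ t, f t| ≤ b := by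
  have hbdd : BddAbove (Set.range f) := ⟨b, by rintro _ ⟨t, rfl⟩; exact (abs_le.1 (hb t)).2⟩
  let t := Classical.arbitrary T
  exact abs_le.2 ⟨(abs_le.1 (hb t)).1.trans (le_ciSup hbdd t),
    ciSup_le fun t ↦ (abs_le.1 (hb t)).2⟩

section CompactSup

variable {T X : Type*} [TopologicalSpace T] [CompactSpace T] [TopologicalSpace X]

lemma continuous_iSup_of_compactSpace {F : X → T → ℝ}
    (hF : Continuous fun q : X × T ↦ F q.1 q.2) : Continuous fun x ↦ ⨆ t, F x t := by
  have h := isCompact_univ (X := T).continuous_sSup (f := F) hF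
  simpa only [Set.image_univ, sSup_range] using h

lemma bddAbove_range_of_compactSpace {f : T → ℝ} (hf : Continuous f) :
    BddAbove (Set.range f) := by
  simpa only [Set.image_univ] using (isCompact_univ (X := T)).bddAbove_image hf.continuousOn

lemma integrable_iSup_of_abs_le [Nonempty T] [MeasurableSpace X] [OpensMeasurableSpace X]
    {ρ : Measure X} {F : X → T → ℝ} (hF : Continuous fun q : X × T ↦ F q.1 q.2) {b : X → ℝ}
    (hb : Integrable b ρ) (hFb : ∀ x t, |F x t| ≤ b x) :
    Integrable (fun x ↦ ⨆ t, F x t) ρ :=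
  hb.mono' (continuous_iSup_of_compactSpace hF).aestronglyMeasurable
    (.of_forall fun x ↦ abs_iSup_le_of_forall_abs_le (hFb x))

end CompactSup

/-- The unit sphere of the Frobenius norm. -/
abbrev FSphere (n r : ℕ) : Type := {B : Matrix (Fin n) (Fin r) ℝ // fnorm B = 1}

/-- The squared Frobenius norm of a matrix. -/
def sqFNorm {n r : ℕ} (Z : Matrix (Fin n) (Fin r) ℝ) : ℝ := ∑ j, ∑ k, Z j k ^ 2

/-- The Frobenius inner product of two matrices. -/
def fInner {n r : ℕ} (B Z : Matrix (Fin n) (Fin r) ℝ) : ℝ := ∑ j, ∑ k, B j k * Z j k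

section Matrices

variable {n r : ℕ}

lemma fnorm_eq_sqrt_sqFNorm (B : Matrix (Fin n) (Fin r) ℝ) :
    fnorm B = Real.sqrt (sqFNorm B) := by
  rw [fnorm, sqFNorm, Finset.sum_comm]
  simp [Matrix.trace, Matrix.mul_apply, sq]

lemma sqFNorm_eq_one (B : FSphere n r) : sqFNorm B.1 = 1 := by
  have h := B.2
  rwa [fnorm_eq_sqrt_sqFNorm, Real.sqrt_eq_one] at h

instance : CompactSpace (FSphere n r) := by
  refine isCompact_iff_compactSpace (s := {B : Matrix (Fin n) (Fin r) ℝ | fnorm B = 1}).1 ?_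
  have hK : IsCompact (Set.univ.pi fun _ : Fin n ↦ Set.univ.pi fun _ : Fin r ↦
      Set.Icc (-1 : ℝ) 1) :=
    isCompact_univ_pi fun _ ↦ isCompact_univ_pi fun _ ↦ isCompact_Icc
  refine hK.of_isClosed_subset ?_ ?_
  · refine isClosed_eq ?_ continuous_const
    unfold fnorm
    fun_prop
  · intro B hB j _ k _
    have h1 : sqFNorm B = 1 := sqFNorm_eq_one ⟨B, hB⟩
    have h2 : B j k ^ 2 ≤ 1 := by
      rw [← h1]
      exact (Finset.single_le_sum (f := fun k ↦ B j k ^ 2) (fun _ _ ↦ sq_nonneg _)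
        (Finset.mem_univ k)).trans (Finset.single_le_sum (f := fun j ↦ ∑ k, B j k ^ 2)
        (fun _ _ ↦ Finset.sum_nonneg fun _ _ ↦ sq_nonneg _) (Finset.mem_univ j))
    exact abs_le.1 (abs_le_one_iff_mul_self_le_one.2 (by rwa [← sq]))

instance : FirstCountableTopology (Matrix (Fin n) (Fin r) ℝ) :=
  inferInstanceAs (FirstCountableTopology (Fin n → Fin r → ℝ))

instance : FirstCountableTopology (FSphere n r) :=
  Topology.IsInducing.subtypeVal.firstCountableTopology

lemma fInner_add (B Z W : Matrix (Fin n) (Fin r) ℝ) :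
    fInner B (Z + W) = fInner B Z + fInner B W := by
  simp [fInner, mul_add, Finset.sum_add_distrib]

lemma abs_fInner_le (B : FSphere n r) (Z : Matrix (Fin n) (Fin r) ℝ) {s : ℝ} (hs : 0 < s) :
    |fInner B.1 Z| ≤ sqFNorm Z / (2 * s) + s / 2 := by
  have key : ∀ j k, |B.1 j k * Z j k| ≤ Z j k ^ 2 / (2 * s) + B.1 j k ^ 2 * (s / 2) := by
    intro j k
    have h : Z j k ^ 2 / (2 * s) + B.1 j k ^ 2 * (s / 2) - |B.1 j k * Z j k| =
        (|Z j k| - s * |B.1 j k|) ^ 2 / (2 * s) := by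
      rw [abs_mul, ← sq_abs (Z j k), ← sq_abs (B.1 j k)]
      field_simp
      ring
    have : 0 ≤ (|Z j k| - s * |B.1 j k|) ^ 2 / (2 * s) := by positivity
    linarith
  calc |fInner B.1 Z| ≤ ∑ j, ∑ k, |B.1 j k * Z j k| :=
        (Finset.abs_sum_le_sum_abs _ _).trans
          (Finset.sum_le_sum fun j _ ↦ Finset.abs_sum_le_sum_abs _ _)
    _ ≤ ∑ j, ∑ k, (Z j k ^ 2 / (2 * s) + B.1 j k ^ 2 * (s / 2)) :=
        Finset.sum_le_sum fun j _ ↦ Finset.sum_le_sum fun k _ ↦ key j k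
    _ = sqFNorm Z / (2 * s) + sqFNorm B.1 * (s / 2) := by
        simp only [Finset.sum_add_distrib, sqFNorm, Finset.sum_div, Finset.sum_mul]
    _ = _ := by rw [sqFNorm_eq_one, one_mul]

lemma fInner_vecMulVec (B : Matrix (Fin n) (Fin r) ℝ) (o : Fin n → ℝ) (g : Fin r → ℝ) :
    fInner B (vecMulVec o g) = g ⬝ᵥ (Bᵀ *ᵥ o) := by
  simp only [fInner, vecMulVec_apply, dotProduct, mulVec, transpose_apply, Finset.mul_sum]
  rw [Finset.sum_comm]
  exact Finset.sum_congr rfl fun _ _ ↦ Finset.sum_congr rfl fun _ _ ↦ by ring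

lemma fInner_smul (c : ℝ) (B Z : Matrix (Fin n) (Fin r) ℝ) :
    fInner B (c • Z) = c * fInner B Z := by
  simp only [fInner, Matrix.smul_apply, smul_eq_mul, Finset.mul_sum]
  exact Finset.sum_congr rfl fun _ _ ↦ Finset.sum_congr rfl fun _ _ ↦ by ring

lemma sqFNorm_add_smul_vecMulVec (Z : Matrix (Fin n) (Fin r) ℝ) (c : ℝ) (o : Fin n → ℝ)
    (g : Fin r → ℝ) :
    sqFNorm (Z + c • vecMulVec o g) = sqFNorm Z + 2 * c * ∑ j, ∑ k, Z j k * (o j * g k) +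
      c ^ 2 * ((∑ j, o j ^ 2) * ∑ k, g k ^ 2) := by
  rw [Finset.sum_mul_sum]
  simp only [sqFNorm, Matrix.add_apply, Matrix.smul_apply, vecMulVec_apply, smul_eq_mul,
    Finset.mul_sum, ← Finset.sum_add_distrib]
  exact Finset.sum_congr rfl fun _ _ ↦ Finset.sum_congr rfl fun _ _ ↦ by ring

lemma vnorm_mulVec_le (B : FSphere n r) (v : Fin n → ℝ) : vnorm (B.1ᵀ *ᵥ v) ≤ vnorm v := by
  refine Real.sqrt_le_sqrt ?_
  calc ∑ k, (B.1ᵀ *ᵥ v) k ^ 2 ≤ ∑ k, (∑ j, B.1 j k ^ 2) * ∑ j, v j ^ 2 :=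
        Finset.sum_le_sum fun k _ ↦ by
          simpa [mulVec, dotProduct] using
            Finset.sum_mul_sq_le_sq_mul_sq Finset.univ (fun j ↦ B.1 j k) v
    _ = sqFNorm B.1 * ∑ j, v j ^ 2 := by rw [sqFNorm, Finset.sum_comm, Finset.sum_mul]
    _ = _ := by rw [sqFNorm_eq_one, one_mul]

lemma continuous_vnorm_mulVec :
    Continuous fun q : (Fin n → ℝ) × FSphere n r ↦ vnorm (q.2.1ᵀ *ᵥ q.1) :=
  continuous_vnorm.comp (by fun_prop)

lemma vnorm_nonneg {k : ℕ} (v : Fin k → ℝ) : 0 ≤ vnorm v := Real.sqrt_nonneg _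

lemma integrable_vnorm_mulVec {σ2 : NNReal} (B : FSphere n r) :
    Integrable (fun v ↦ vnorm (B.1ᵀ *ᵥ v)) (gaussianVec n σ2) :=
  integrable_vnorm_gaussianVec.mono'
    (continuous_vnorm_mulVec.comp (.prodMk_left B)).aestronglyMeasurable
    (.of_forall fun v ↦ by
      rw [Real.norm_of_nonneg (vnorm_nonneg _)]
      exact vnorm_mulVec_le B v)

/-- The centred value `‖Bᵀv‖ - E‖Bᵀo‖`. -/
def centered (σ2 : NNReal) (v : Fin n → ℝ) (B : FSphere n r) : ℝ :=
  vnorm (B.1ᵀ *ᵥ v) - ∫ w, vnorm (B.1ᵀ *ᵥ w) ∂(gaussianVec n σ2)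

lemma continuous_centered (σ2 : NNReal) :
    Continuous fun q : (Fin n → ℝ) × FSphere n r ↦ centered σ2 q.1 q.2 := by
  refine continuous_vnorm_mulVec.sub (Continuous.comp (g := fun B : FSphere n r ↦
    ∫ w, vnorm (B.1ᵀ *ᵥ w) ∂(gaussianVec n σ2)) ?_ continuous_snd)
  refine continuous_of_dominated
    (F := fun (B : FSphere n r) w ↦ vnorm (B.1ᵀ *ᵥ w)) (bound := vnorm)
    (fun B ↦ (integrable_vnorm_mulVec B).aestronglyMeasurable) (fun B ↦ .of_forall fun v ↦ ?_)
    integrable_vnorm_gaussianVec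
    (.of_forall fun v ↦ continuous_vnorm.comp (by fun_prop))
  rw [Real.norm_of_nonneg (vnorm_nonneg _)]
  exact vnorm_mulVec_le B v

lemma continuous_centered_comp {Y : Type*} [TopologicalSpace Y] (σ2 : NNReal) {f : Y → Fin n → ℝ}
    {g : Y → FSphere n r} (hf : Continuous f) (hg : Continuous g) :
    Continuous fun y ↦ centered σ2 (f y) (g y) :=
  (continuous_centered σ2).comp (f := fun y ↦ (f y, g y)) (hf.prodMk hg)

lemma abs_centered_le (σ2 : NNReal) (v : Fin n → ℝ) (B : FSphere n r) :
    |centered σ2 v B| ≤ vnorm v + ∫ w, vnorm w ∂(gaussianVec n σ2) := by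
  have h1 : 0 ≤ ∫ w, vnorm (B.1ᵀ *ᵥ w) ∂(gaussianVec n σ2) :=
    integral_nonneg fun _ ↦ vnorm_nonneg _
  have h2 : ∫ w, vnorm (B.1ᵀ *ᵥ w) ∂(gaussianVec n σ2) ≤ ∫ w, vnorm w ∂(gaussianVec n σ2) :=
    integral_mono (integrable_vnorm_mulVec B) integrable_vnorm_gaussianVec (vnorm_mulVec_le B)
  have h3 := vnorm_nonneg (B.1ᵀ *ᵥ v)
  have h4 := vnorm_mulVec_le B v
  rw [centered, abs_le]
  constructor <;> linarith

lemma continuous_fInner {X : Type*} [TopologicalSpace X] {W : X → Matrix (Fin n) (Fin r) ℝ}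
    (hW : Continuous W) : Continuous fun q : X × FSphere n r ↦ fInner q.2.1 (W q.1) := by
  refine continuous_finsetSum _ fun j _ ↦ continuous_finsetSum _ fun k _ ↦ ?_
  exact ((continuous_subtype_val.comp continuous_snd).matrix_elem j k).mul
    ((hW.comp continuous_fst).matrix_elem j k)

lemma continuous_fInner_add_smul_vecMulVec (Z : Matrix (Fin n) (Fin r) ℝ) (c : ℝ) :
    Continuous fun q : ((Fin n → ℝ) × (Fin r → ℝ)) × FSphere n r ↦
      fInner q.2.1 (Z + c • vecMulVec q.1.1 q.1.2) :=
  continuous_fInner (W := fun p : (Fin n → ℝ) × (Fin r → ℝ) ↦ Z + c • vecMulVec p.1 p.2)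
    (continuous_const.add ((continuous_fst.matrix_vecMulVec continuous_snd).const_smul c))

lemma integrable_sqFNorm_add_smul_vecMulVec (σ2 : NNReal) (Z : Matrix (Fin n) (Fin r) ℝ) (c : ℝ) :
    Integrable (fun p : (Fin n → ℝ) × (Fin r → ℝ) ↦ sqFNorm (Z + c • vecMulVec p.1 p.2))
      ((gaussianVec n σ2).prod (gaussianVec r 1)) := by
  simp_rw [sqFNorm_add_smul_vecMulVec]
  refine ((integrable_const _).add (.const_mul (integrable_finsetSum _ fun j _ ↦
    integrable_finsetSum _ fun k _ ↦ .const_mul ?_ _) _)).add (.const_mul ?_ _)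
  · exact (integrable_eval_gaussianVec j).mul_prod (integrable_eval_gaussianVec k)
  · exact integrable_sum_sq_gaussianVec.mul_prod integrable_sum_sq_gaussianVec

lemma integral_sqFNorm_add_smul_vecMulVec (σ2 : NNReal) (Z : Matrix (Fin n) (Fin r) ℝ) (c : ℝ) :
    ∫ p : (Fin n → ℝ) × (Fin r → ℝ), sqFNorm (Z + c • vecMulVec p.1 p.2)
      ∂((gaussianVec n σ2).prod (gaussianVec r 1)) = sqFNorm Z + c ^ 2 * (n * σ2 * r) := by
  have h1 : ∀ j k, Integrable (fun p : (Fin n → ℝ) × (Fin r → ℝ) ↦ Z j k * (p.1 j * p.2 k))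
      ((gaussianVec n σ2).prod (gaussianVec r 1)) := fun j k ↦
    .const_mul ((integrable_eval_gaussianVec j).mul_prod (integrable_eval_gaussianVec k)) _
  have h2 : ∀ j, Integrable (fun p : (Fin n → ℝ) × (Fin r → ℝ) ↦ ∑ k, Z j k * (p.1 j * p.2 k))
      ((gaussianVec n σ2).prod (gaussianVec r 1)) := fun j ↦ integrable_finsetSum _ fun k _ ↦ h1 j k
  have h3 : Integrable (fun p : (Fin n → ℝ) × (Fin r → ℝ) ↦ (∑ j, p.1 j ^ 2) * ∑ k, p.2 k ^ 2)
      ((gaussianVec n σ2).prod (gaussianVec r 1)) :=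
    integrable_sum_sq_gaussianVec.mul_prod integrable_sum_sq_gaussianVec
  have h4 : Integrable (fun p : (Fin n → ℝ) × (Fin r → ℝ) ↦
      2 * c * ∑ j, ∑ k, Z j k * (p.1 j * p.2 k))
      ((gaussianVec n σ2).prod (gaussianVec r 1)) :=
    .const_mul (integrable_finsetSum _ fun j _ ↦ h2 j) _
  have h5 : Integrable (fun p : (Fin n → ℝ) × (Fin r → ℝ) ↦
      sqFNorm Z + 2 * c * ∑ j, ∑ k, Z j k * (p.1 j * p.2 k))
      ((gaussianVec n σ2).prod (gaussianVec r 1)) := (integrable_const _).add h4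
  simp_rw [sqFNorm_add_smul_vecMulVec]
  rw [integral_add h5 (h3.const_mul _),
    integral_add (integrable_const _) h4, integral_const_mul, integral_const_mul,
    integral_finsetSum _ fun j _ ↦ h2 j,
    integral_prod_mul (fun o : Fin n → ℝ ↦ ∑ j, o j ^ 2) (fun g : Fin r → ℝ ↦ ∑ k, g k ^ 2),
    integral_sum_sq_gaussianVec, integral_sum_sq_gaussianVec]
  have h6 : ∀ j, ∫ p : (Fin n → ℝ) × (Fin r → ℝ), ∑ k, Z j k * (p.1 j * p.2 k)
      ∂((gaussianVec n σ2).prod (gaussianVec r 1)) = 0 := by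
    intro j
    rw [integral_finsetSum _ fun k _ ↦ h1 j k]
    refine Finset.sum_eq_zero fun k _ ↦ ?_
    rw [integral_const_mul, integral_prod_mul (fun o : Fin n → ℝ ↦ o j) (fun g : Fin r → ℝ ↦ g k),
      integral_eval_gaussianVec]
    simp
  simp [h6]

lemma exists_abs_le_of_continuous {R : FSphere n r → ℝ} (hR : Continuous R) :
    ∃ C, ∀ B, |R B| ≤ C := by
  obtain ⟨C, hC⟩ := bddAbove_range_of_compactSpace hR.abs
  exact ⟨C, fun B ↦ hC ⟨B, rfl⟩⟩

/-- A randomised linear functional dominates differences of the norms `‖Bᵀo‖`. -/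
lemma vnorm_sub_vnorm_add_le_integral_iSup {R : FSphere n r → ℝ} (hR : Continuous R)
    (o : Fin n → ℝ) (B B' : FSphere n r) :
    (vnorm (B.1ᵀ *ᵥ o) + R B / 2) + (-vnorm (B'.1ᵀ *ᵥ o) + R B' / 2) ≤
      ∫ g, ⨆ A : FSphere n r, (fInner A.1 ((2 * Real.sqrt 2) • vecMulVec o g) + R A)
        ∂(gaussianVec r 1) := by
  have : Nonempty (FSphere n r) := ⟨B⟩
  set c := 2 * Real.sqrt 2 with hc
  set h : (Fin r → ℝ) → ℝ := fun g ↦ ⨆ A : FSphere n r, (fInner A.1 (c • vecMulVec o g) + R A)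
  obtain ⟨C, hC⟩ := exists_abs_le_of_continuous hR
  have hcont : Continuous fun q : (Fin r → ℝ) × FSphere n r ↦
      fInner q.2.1 (c • vecMulVec o q.1) + R q.2 :=
    (continuous_fInner (W := fun g : Fin r → ℝ ↦ c • vecMulVec o g)
      ((continuous_const.matrix_vecMulVec continuous_id).const_smul c)).add
      (hR.comp continuous_snd)
  have hsq : ∀ g : Fin r → ℝ, sqFNorm (c • vecMulVec o g) =
      c ^ 2 * ((∑ j, o j ^ 2) * ∑ k, g k ^ 2) := by
    intro g
    have := sqFNorm_add_smul_vecMulVec 0 c o g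
    simpa [sqFNorm] using this
  have hint : Integrable h (gaussianVec r 1) := by
    refine integrable_iSup_of_abs_le hcont
      (b := fun g ↦ (c ^ 2 * ((∑ j, o j ^ 2) * ∑ k, g k ^ 2)) / (2 * 1) + 1 / 2 + C) ?_ ?_
    · exact (((((integrable_sum_sq_gaussianVec).const_mul _).const_mul _).div_const _).add
        (integrable_const _)).add (integrable_const _)
    · intro g A
      rw [← hsq]
      exact (abs_add_le _ _).trans (add_le_add (abs_fInner_le A _ one_pos) (hC A))
  have hint_neg : Integrable (fun g ↦ h (-g)) (gaussianVec r 1) :=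
    integrable_comp_neg_gaussianVec hint
  have hle : ∀ g A, c * (g ⬝ᵥ (A.1ᵀ *ᵥ o)) + R A ≤ h g := by
    intro g A
    rw [← fInner_vecMulVec, ← fInner_smul]
    exact le_ciSup (f := fun A : FSphere n r ↦ fInner A.1 (c • vecMulVec o g) + R A)
      (bddAbove_range_of_compactSpace (hcont.comp (.prodMk_right g))) A
  set d := B.1ᵀ *ᵥ o - B'.1ᵀ *ᵥ o with hd
  have hpt : ∀ g, 2 * |Real.sqrt 2 * (g ⬝ᵥ d)| + (R B + R B') ≤ h g + h (-g) := by
    intro g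
    have e1 := hle g B
    have e2 := hle g B'
    have e3 := hle (-g) B
    have e4 := hle (-g) B'
    rw [neg_dotProduct] at e3 e4
    rw [hd, dotProduct_sub]
    rcases abs_cases (Real.sqrt 2 * (g ⬝ᵥ (B.1ᵀ *ᵥ o) - g ⬝ᵥ (B'.1ᵀ *ᵥ o))) with ⟨h', _⟩ | ⟨h', _⟩ <;>
      rw [h'] <;> rw [hc] at e1 e2 e3 e4 <;> linarith
  have hintd : Integrable (fun g ↦ |Real.sqrt 2 * (g ⬝ᵥ d)|) (gaussianVec r 1) :=
    (Integrable.const_mul (integrable_finsetSum _ fun k _ ↦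
      (integrable_eval_gaussianVec k).mul_const _) _).abs
  have hmono := integral_mono ((hintd.const_mul 2).add (integrable_const (R B + R B')))
    (hint.add hint_neg) hpt
  simp only [Pi.add_apply] at hmono
  rw [integral_add (hintd.const_mul 2) (integrable_const _), integral_add hint hint_neg,
    integral_comp_neg_gaussianVec, integral_const_mul] at hmono
  simp only [integral_const, probReal_univ, one_smul] at hmono
  have hv := vnorm_le_integral_abs_dotProduct d
  have hs := vnorm_sub_le (B.1ᵀ *ᵥ o) (B'.1ᵀ *ᵥ o)
  linarith

/-- Decoupling of a single Gaussian vector. -/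
lemma integral_iSup_centered_add_le [Nonempty (FSphere n r)] (σ2 : NNReal) {R : FSphere n r → ℝ}
    (hR : Continuous R) :
    ∫ o, ⨆ B : FSphere n r, (centered σ2 o B + R B) ∂(gaussianVec n σ2) ≤
      ∫ p : (Fin n → ℝ) × (Fin r → ℝ), ⨆ B : FSphere n r,
        (fInner B.1 ((2 * Real.sqrt 2) • vecMulVec p.1 p.2) + R B)
        ∂((gaussianVec n σ2).prod (gaussianVec r 1)) := by
  set c := 2 * Real.sqrt 2 with hc
  obtain ⟨C, hC⟩ := exists_abs_le_of_continuous hR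
  set U : (Fin n → ℝ) → ℝ := fun o ↦ ⨆ B : FSphere n r, (vnorm (B.1ᵀ *ᵥ o) + R B / 2)
  set V : (Fin n → ℝ) → ℝ := fun o ↦ ⨆ B : FSphere n r, (-vnorm (B.1ᵀ *ᵥ o) + R B / 2)
  have hR2 : Continuous fun q : (Fin n → ℝ) × FSphere n r ↦ R q.2 / 2 :=
    (hR.comp continuous_snd).div_const 2
  have hUc := continuous_vnorm_mulVec.add hR2
  have hVc := continuous_vnorm_mulVec.neg.add hR2
  have hbound : Integrable (fun o ↦ vnorm o + C / 2) (gaussianVec n σ2) :=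
    integrable_vnorm_gaussianVec.add (integrable_const _)
  have hfin : ∀ (o : Fin n → ℝ) (B : FSphere n r), 0 ≤ vnorm (B.1ᵀ *ᵥ o) ∧
      vnorm (B.1ᵀ *ᵥ o) ≤ vnorm o ∧ -C ≤ R B ∧ R B ≤ C := fun o B ↦
    ⟨vnorm_nonneg _, vnorm_mulVec_le B o, (abs_le.1 (hC B)).1, (abs_le.1 (hC B)).2⟩
  have hUi : Integrable U (gaussianVec n σ2) := by
    refine integrable_iSup_of_abs_le hUc hbound fun o B ↦ ?_
    obtain ⟨h1, h2, h3, h4⟩ := hfin o B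
    rw [abs_le]; constructor <;> linarith
  have hVi : Integrable V (gaussianVec n σ2) := by
    refine integrable_iSup_of_abs_le hVc hbound fun o B ↦ ?_
    obtain ⟨h1, h2, h3, h4⟩ := hfin o B
    rw [abs_le]; constructor <;> linarith
  have hleU : ∀ o B, vnorm (B.1ᵀ *ᵥ o) + R B / 2 ≤ U o := fun o B ↦
    le_ciSup (bddAbove_range_of_compactSpace (hUc.comp (.prodMk_right o))) B
  have hleV : ∀ o B, -vnorm (B.1ᵀ *ᵥ o) + R B / 2 ≤ V o := fun o B ↦
    le_ciSup (bddAbove_range_of_compactSpace (hVc.comp (.prodMk_right o))) B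
  have hLi : Integrable (fun o ↦ ⨆ B : FSphere n r, (centered σ2 o B + R B))
      (gaussianVec n σ2) :=
    integrable_iSup_of_abs_le ((continuous_centered σ2).add (hR.comp continuous_snd))
      (b := fun o ↦ vnorm o + (∫ w, vnorm w ∂(gaussianVec n σ2)) + C)
      ((integrable_vnorm_gaussianVec.add (integrable_const _)).add (integrable_const _))
      fun o B ↦ (abs_add_le _ _).trans (add_le_add (abs_centered_le σ2 o B) (hC B))
  have hmean : ∀ B : FSphere n r,
      -(∫ w, vnorm (B.1ᵀ *ᵥ w) ∂(gaussianVec n σ2)) + R B / 2 ≤ ∫ w, V w ∂(gaussianVec n σ2) := by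
    intro B
    have h := integral_mono ((integrable_vnorm_mulVec B).neg.add (integrable_const (R B / 2)))
      hVi (fun w ↦ hleV w B)
    rw [integral_add' (integrable_vnorm_mulVec B).neg (integrable_const _), integral_neg'] at h
    simpa using h
  have hGi : Integrable (fun p : (Fin n → ℝ) × (Fin r → ℝ) ↦ ⨆ B : FSphere n r,
      (fInner B.1 (c • vecMulVec p.1 p.2) + R B))
      ((gaussianVec n σ2).prod (gaussianVec r 1)) := by
    have hc0 := continuous_fInner_add_smul_vecMulVec (n := n) (r := r) 0 c
    have hi0 := integrable_sqFNorm_add_smul_vecMulVec (n := n) (r := r) σ2 0 c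
    simp only [zero_add] at hc0 hi0
    exact integrable_iSup_of_abs_le (hc0.add (hR.comp continuous_snd))
      (((hi0.div_const (2 * 1)).add (integrable_const (1 / 2))).add (integrable_const C))
      fun p B ↦ (abs_add_le _ _).trans (add_le_add (abs_fInner_le B _ one_pos) (hC B))
  calc ∫ o, ⨆ B : FSphere n r, (centered σ2 o B + R B) ∂(gaussianVec n σ2)
      ≤ ∫ o, (U o + ∫ w, V w ∂(gaussianVec n σ2)) ∂(gaussianVec n σ2) := by
        refine integral_mono hLi (hUi.add (integrable_const _)) fun o ↦ ciSup_le fun B ↦ ?_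
        have h1 := hleU o B
        have h2 := hmean B
        simp only [centered]
        linarith
    _ = ∫ o, (U o + V o) ∂(gaussianVec n σ2) := by
        rw [integral_add hUi (integrable_const _), integral_add hUi hVi]
        simp
    _ ≤ ∫ o, ∫ g, ⨆ B : FSphere n r, (fInner B.1 (c • vecMulVec o g) + R B)
          ∂(gaussianVec r 1) ∂(gaussianVec n σ2) := by
        refine integral_mono (hUi.add hVi) hGi.integral_prod_left fun o ↦ ?_
        refine le_sub_iff_add_le.1 (ciSup_le fun B ↦ ?_)
        rw [le_sub_comm]
        refine ciSup_le fun B' ↦ ?_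
        rw [le_sub_iff_add_le']
        exact vnorm_sub_vnorm_add_le_integral_iSup hR o B B'
    _ = _ := (integral_prod _ hGi).symm

lemma integrable_sum_vnorm_add (σ2 : NNReal) (m : ℕ) (a : ℝ) :
    Integrable (fun ω : Fin m → Fin n → ℝ ↦ ∑ i, (vnorm (ω i) + a))
      (Measure.pi fun _ : Fin m ↦ gaussianVec n σ2) :=
  integrable_finsetSum _ fun i _ ↦
    (integrable_comp_eval (μ := fun _ : Fin m ↦ gaussianVec n σ2) (i := i)
      (integrable_vnorm_gaussianVec)).add (integrable_const a)

lemma continuous_add_sum_centered {X : Type*} [TopologicalSpace X] (σ2 : NNReal) (m : ℕ)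
    {K : X → FSphere n r → ℝ} (hK : Continuous fun q : X × FSphere n r ↦ K q.1 q.2) :
    Continuous fun q : (X × (Fin m → Fin n → ℝ)) × FSphere n r ↦
      K q.1.1 q.2 + ∑ i, centered σ2 (q.1.2 i) q.2 := by
  have h1 : Continuous fun q : (X × (Fin m → Fin n → ℝ)) × FSphere n r ↦ K q.1.1 q.2 :=
    hK.comp (f := fun q : (X × (Fin m → Fin n → ℝ)) × FSphere n r ↦ (q.1.1, q.2))
      ((continuous_fst.comp continuous_fst).prodMk continuous_snd)
  refine h1.add (continuous_finsetSum _ fun i _ ↦ ?_)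
  exact continuous_centered_comp σ2 ((continuous_apply i).comp (continuous_snd.comp continuous_fst))
    continuous_snd

lemma integrable_iSup_add_sum_centered [Nonempty (FSphere n r)] {X : Type*} [TopologicalSpace X]
    [SecondCountableTopology X] [MeasurableSpace X] [BorelSpace X] {ρ : Measure X}
    [IsFiniteMeasure ρ] (σ2 : NNReal) (m : ℕ) {K : X → FSphere n r → ℝ}
    (hK : Continuous fun q : X × FSphere n r ↦ K q.1 q.2) {b : X → ℝ} (hb : Integrable b ρ)
    (hKb : ∀ x B, |K x B| ≤ b x) :
    Integrable (fun q : X × (Fin m → Fin n → ℝ) ↦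
        ⨆ B : FSphere n r, (K q.1 B + ∑ i, centered σ2 (q.2 i) B))
      (ρ.prod (Measure.pi fun _ : Fin m ↦ gaussianVec n σ2)) := by
  have hs := integrable_sum_vnorm_add (n := n) σ2 m (∫ w : Fin n → ℝ, vnorm w ∂(gaussianVec n σ2))
  refine integrable_iSup_of_abs_le (F := fun (q : X × (Fin m → Fin n → ℝ)) (B : FSphere n r) ↦
    K q.1 B + ∑ i, centered σ2 (q.2 i) B) (continuous_add_sum_centered σ2 m hK)
    ((hb.comp_fst _).add (hs.comp_snd _)) fun q B ↦ ?_
  exact (abs_add_le _ _).trans (add_le_add (hKb _ _) ((Finset.abs_sum_le_sum_abs _ _).trans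
    (Finset.sum_le_sum fun i _ ↦ abs_centered_le σ2 (q.2 i) B)))

/-- A bound on the expected supremum of the centred process with an added linear functional. -/
lemma integral_iSup_fInner_add_sum_centered_le [Nonempty (FSphere n r)] (σ2 : NNReal) (m : ℕ)
    (Z : Matrix (Fin n) (Fin r) ℝ) {s : ℝ} (hs : 0 < s) :
    ∫ ω : Fin m → Fin n → ℝ, ⨆ B : FSphere n r, (fInner B.1 Z + ∑ i, centered σ2 (ω i) B)
      ∂(Measure.pi fun _ : Fin m ↦ gaussianVec n σ2) ≤
    (sqFNorm Z + 8 * (n * σ2 * r) * m) / (2 * s) + s / 2 := by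
  induction m generalizing Z with
  | zero =>
    have h := ciSup_le fun B : FSphere n r ↦ (abs_le.1 (abs_fInner_le B Z hs)).2
    simpa using h
  | succ m ih =>
    set c := 2 * Real.sqrt 2 with hc
    have hc2 : c ^ 2 = 8 := by
      rw [hc, mul_pow, Real.sq_sqrt (by norm_num)]; norm_num
    set P := Measure.pi fun _ : Fin m ↦ gaussianVec n σ2
    set ρ := (gaussianVec n σ2).prod (gaussianVec r 1)
    have hsplit := (measurePreserving_piFinSuccAbove (fun _ : Fin (m + 1) ↦ gaussianVec n σ2)
      0).integral_comp' (fun q : (Fin n → ℝ) × (Fin m → Fin n → ℝ) ↦ ⨆ B : FSphere n r,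
        ((centered σ2 q.1 B + fInner B.1 Z) + ∑ i, centered σ2 (q.2 i) B))
    have hZ : Continuous fun B : FSphere n r ↦ fInner B.1 Z :=
      (continuous_fInner (W := fun _ : Unit ↦ Z) continuous_const).comp (.prodMk_right ())
    have hi1 : Integrable (fun q : (Fin n → ℝ) × (Fin m → Fin n → ℝ) ↦ ⨆ B : FSphere n r,
        ((centered σ2 q.1 B + fInner B.1 Z) + ∑ i, centered σ2 (q.2 i) B))
        ((gaussianVec n σ2).prod P) :=
      integrable_iSup_add_sum_centered σ2 m
        (K := fun o B ↦ centered σ2 o B + fInner B.1 Z)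
        ((continuous_centered σ2).add (hZ.comp continuous_snd))
        ((integrable_vnorm_gaussianVec.add (integrable_const _)).add (integrable_const _))
        fun o B ↦ (abs_add_le _ _).trans
          (add_le_add (abs_centered_le σ2 o B) (abs_fInner_le B Z one_pos))
    have hi2 : Integrable (fun q : ((Fin n → ℝ) × (Fin r → ℝ)) × (Fin m → Fin n → ℝ) ↦
        ⨆ B : FSphere n r,
          (fInner B.1 (Z + c • vecMulVec q.1.1 q.1.2) + ∑ i, centered σ2 (q.2 i) B))
        (ρ.prod P) :=
      integrable_iSup_add_sum_centered σ2 m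
        (K := fun (p : (Fin n → ℝ) × (Fin r → ℝ)) B ↦ fInner B.1 (Z + c • vecMulVec p.1 p.2))
        (continuous_fInner_add_smul_vecMulVec Z c)
        (((integrable_sqFNorm_add_smul_vecMulVec σ2 Z c).div_const (2 * 1)).add
          (integrable_const (1 / 2)))
        fun p B ↦ abs_fInner_le B _ one_pos
    have hi3 : Integrable (fun p : (Fin n → ℝ) × (Fin r → ℝ) ↦
        sqFNorm (Z + c • vecMulVec p.1 p.2) + 8 * (n * σ2 * r) * m) ρ :=
      (integrable_sqFNorm_add_smul_vecMulVec σ2 Z c).add (integrable_const _)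
    calc ∫ ω : Fin (m + 1) → Fin n → ℝ, ⨆ B : FSphere n r,
          (fInner B.1 Z + ∑ i, centered σ2 (ω i) B)
          ∂(Measure.pi fun _ : Fin (m + 1) ↦ gaussianVec n σ2)
        = ∫ q, ⨆ B : FSphere n r,
            ((centered σ2 q.1 B + fInner B.1 Z) + ∑ i, centered σ2 (q.2 i) B)
            ∂((gaussianVec n σ2).prod P) := by
          rw [← hsplit]
          refine integral_congr_ae (.of_forall fun ω ↦ ?_)
          simp only [Fin.sum_univ_succ]
          refine iSup_congr fun B ↦ ?_
          simp only [MeasurableEquiv.piFinSuccAbove_apply, Fin.insertNthEquiv_zero,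
            Fin.consEquiv_symm_apply, Fin.tail]
          ring
      _ = ∫ ω, ∫ o, ⨆ B : FSphere n r,
            (centered σ2 o B + (fInner B.1 Z + ∑ i, centered σ2 (ω i) B))
            ∂(gaussianVec n σ2) ∂P := by
          rw [integral_prod_symm _ hi1]
          simp only [add_assoc]
      _ ≤ ∫ ω, ∫ p : (Fin n → ℝ) × (Fin r → ℝ), ⨆ B : FSphere n r,
            (fInner B.1 (Z + c • vecMulVec p.1 p.2) + ∑ i, centered σ2 (ω i) B) ∂ρ ∂P := by
          refine integral_mono ?_ hi2.integral_prod_right fun ω ↦ ?_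
          · simpa only [add_assoc] using hi1.integral_prod_right
          · have hR : Continuous fun B : FSphere n r ↦
                fInner B.1 Z + ∑ i, centered σ2 (ω i) B :=
              hZ.add (continuous_finsetSum _ fun i _ ↦
                continuous_centered_comp σ2 continuous_const continuous_id)
            refine (integral_iSup_centered_add_le σ2 hR).trans_eq ?_
            refine integral_congr_ae (.of_forall fun p ↦ iSup_congr fun B ↦ ?_)
            rw [fInner_add]
            ring
      _ = ∫ p : (Fin n → ℝ) × (Fin r → ℝ), ∫ ω, ⨆ B : FSphere n r,
            (fInner B.1 (Z + c • vecMulVec p.1 p.2) + ∑ i, centered σ2 (ω i) B) ∂P ∂ρ :=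
          (integral_integral_swap hi2).symm
      _ ≤ ∫ p : (Fin n → ℝ) × (Fin r → ℝ),
            ((sqFNorm (Z + c • vecMulVec p.1 p.2) + 8 * (n * σ2 * r) * m) / (2 * s) + s / 2) ∂ρ :=
          integral_mono hi2.integral_prod_left
            ((hi3.div_const _).add (integrable_const _)) fun p ↦ ih _
      _ = _ := by
          rw [integral_add (hi3.div_const _) (integrable_const _), integral_div,
            integral_add (integrable_sqFNorm_add_smul_vecMulVec σ2 Z c) (integrable_const _),
            integral_sqFNorm_add_smul_vecMulVec, hc2]
          simp only [integral_const, probReal_univ, one_smul, Nat.cast_add, Nat.cast_one]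
          ring

end Matrices

/-- With independent oᵢ ~ N(0,(1/n)Iₙ), the expected supremum of the centered
empirical process B ↦ ∑ᵢ(‖Bᵀoᵢ‖₂ − E‖Bᵀo‖₂) over the Frobenius unit sphere is at most
2√(2m₂r). -/
theorem haystack_centered_sup_expectation (n r m₂ : ℕ) :
    ∫ ω, sSup {t | ∃ B : Matrix (Fin n) (Fin r) ℝ, fnorm B = 1 ∧
          t = ∑ i, (vnorm (Bᵀ *ᵥ ω i)
                - ∫ v, vnorm (Bᵀ *ᵥ v) ∂(gaussianVec n (1 / (n : NNReal))))}
        ∂(Measure.pi fun _ : Fin m₂ => gaussianVec n (1 / (n : NNReal)))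
      ≤ 2 * Real.sqrt (2 * (m₂ : ℝ) * (r : ℝ)) := by
  have hset : ∀ ω : Fin m₂ → Fin n → ℝ,
      sSup {t | ∃ B : Matrix (Fin n) (Fin r) ℝ, fnorm B = 1 ∧
          t = ∑ i, (vnorm (Bᵀ *ᵥ ω i)
                - ∫ v, vnorm (Bᵀ *ᵥ v) ∂(gaussianVec n (1 / (n : NNReal))))} =
        ⨆ B : FSphere n r, ∑ i, centered (1 / (n : NNReal)) (ω i) B := by
    intro ω
    rw [iSup]
    congr 1
    ext t
    simp [centered, eq_comm]
  simp_rw [hset]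
  rcases isEmpty_or_nonempty (FSphere n r) with hE | hE
  · simp only [Real.iSup_of_isEmpty, integral_zero]
    positivity
  have hbound : ∀ s : ℝ, 0 < s → ∫ ω : Fin m₂ → Fin n → ℝ,
      ⨆ B : FSphere n r, ∑ i, centered (1 / (n : NNReal)) (ω i) B
      ∂(Measure.pi fun _ : Fin m₂ => gaussianVec n (1 / (n : NNReal))) ≤
      (8 * r * m₂) / (2 * s) + s / 2 := by
    intro s hs
    have h := integral_iSup_fInner_add_sum_centered_le (n := n) (r := r) (1 / (n : NNReal)) m₂ 0 hs
    have hn : (n : ℝ) ≠ 0 := by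
      obtain ⟨B⟩ := hE
      rintro h0
      obtain rfl : n = 0 := by exact_mod_cast h0
      have := sqFNorm_eq_one B
      simp [sqFNorm] at this
    have hv : (n : ℝ) * ((1 / (n : NNReal) : NNReal) : ℝ) = 1 := by
      push_cast
      field_simp
    rw [hv] at h
    simpa [fInner, sqFNorm] using h
  set x : ℝ := 2 * (m₂ : ℝ) * (r : ℝ) with hx
  have hx0 : 0 ≤ x := by positivity
  rcases hx0.eq_or_lt with h0 | hpos
  · rw [← h0, Real.sqrt_zero, mul_zero]
    refine le_of_forall_pos_le_add fun ε hε ↦ ?_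
    have h := hbound ε hε
    have h1 : (8 * r * m₂ : ℝ) = 4 * x := by rw [hx]; ring
    rw [h1, ← h0] at h
    simp only [mul_zero, zero_div, zero_add] at h
    linarith
  · have hsx : 0 < Real.sqrt x := Real.sqrt_pos.2 hpos
    have h := hbound (2 * Real.sqrt x) (by positivity)
    have h1 : (8 * r * m₂ : ℝ) / (2 * (2 * Real.sqrt x)) = Real.sqrt x := by
      rw [show (8 * r * m₂ : ℝ) = 4 * x by rw [hx]; ring]
      rw [div_eq_iff (by positivity)]
      linarith [Real.mul_self_sqrt hx0]
    rw [h1] at h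
    linarith

end
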